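/- There is no birational surjective rational parametrization of the Fermat cubic surface. Precisely: there do not exist polynomials p₁, p₂, p₃, q₁, q₂, q₃ ∈ ℂ[s,t] with each qᵢ ≠ 0 and gcd(pᵢ, qᵢ) = 1, and a nonzero polynomial h ∈ ℂ[s,t], such that, setting U = {(s,t) ∈ ℂ² : q₁(s,t)·q₂(s,t)·q₃(s,t) ≠ 0} and f(s,t) = (p₁(s,t)/q₁(s,t), p₂(s,t)/q₂(s,t), p₃(s,t)/q₃(s,t)) for (s,t) ∈ U, one has both (i) f(U) = S, where S = {(x,y,z) ∈ ℂ³ : x³ + y³ + z³ = 1}, and (ii) f is injective on {(s,t) ∈ U : h(s,t) ≠ 0}. -/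

import Mathlib

/-- A Noetherian subring `A` of a domain `B` is all of `B` as soon as it is integrally closed in
`B`, `B` lies in the fraction field of `A`, and every prime of `A` is contracted from `B`. -/
theorem Subalgebra.eq_top_of_isIntegrallyClosedIn_of_contracted_primes
    {k B : Type*} [CommRing k] [CommRing B] [IsDomain B] [Algebra k B] (A : Subalgebra k B)
    [IsNoetherianRing A]
    (hint : ∀ y : B, IsIntegral A y → y ∈ A)
    (hfrac : ∀ y : B, ∃ a ∈ A, a ≠ 0 ∧ a * y ∈ A)
    (hcontr : ∀ P : Ideal A, P.IsPrime → ∀ p ∈ P, ∀ y : B, ∀ u : A,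
      (u : B) = y * p → u ∈ P) : A = ⊤ := by
  by_contra hne
  obtain ⟨g, hg⟩ : ∃ g : B, g ∉ A := by
    by_contra! h
    exact hne (eq_top_iff.2 fun x _ => h x)
  let I : B → Ideal A := fun y =>
    { carrier := {r | (r : B) * y ∈ A}
      add_mem' := fun {a b} ha hb => by
        simpa [add_mul] using A.add_mem ha hb
      zero_mem' := by simp
      smul_mem' := fun c x hx => by
        simpa [mul_assoc] using A.mul_mem c.2 hx }
  have hI : ∀ y (r : A), r ∈ I y ↔ (r : B) * y ∈ A := fun _ _ => Iff.rfl
  obtain ⟨P, ⟨y, hy, rfl⟩, hmax⟩ := set_has_maximal_iff_noetherian.2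
    (inferInstance : IsNoetherian A A) {J : Ideal A | ∃ y, y ∉ A ∧ I y = J} ⟨_, g, hg, rfl⟩
  have hprime : (I y).IsPrime := by
    refine ⟨fun h => hy ?_, fun {r s} hrs => ?_⟩
    · have : (1 : A) ∈ I y := h ▸ Submodule.mem_top
      simpa [hI] using this
    · by_contra! h
      have hle : I y ≤ I (r * y) := fun t ht => by
        rw [hI] at ht ⊢
        have := A.mul_mem r.2 ht
        convert this using 1
        ring
      have hs : s ∈ I (r * y) := by
        rw [hI] at hrs ⊢
        convert hrs using 1
        push_cast
        ring
      exact hmax _ ⟨r * y, h.1, rfl⟩ (lt_of_le_of_ne hle fun e => h.2 (e ▸ hs))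
  by_cases hcase : ∀ p ∈ I y, ∃ v ∈ I y, (v : B) = y * p
  · refine hy (hint y ?_)
    refine isIntegral_of_smul_mem_submodule (M := B)
      (Submodule.map (Algebra.linearMap A B) (I y)) ?_ ?_ y ?_
    · obtain ⟨a, ha, ha0, hay⟩ := hfrac y
      refine fun h => ha0 ?_
      have : algebraMap A B ⟨a, ha⟩ ∈ Submodule.map (Algebra.linearMap A B) (I y) :=
        ⟨⟨a, ha⟩, hay, rfl⟩
      rw [h] at this
      simpa using this
    · exact (IsNoetherian.noetherian (I y)).map _
    · rintro _ ⟨p, hp, rfl⟩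
      obtain ⟨v, hv, e⟩ := hcase p hp
      exact ⟨v, hv, e⟩
  · push Not at hcase
    obtain ⟨p, hp, hv⟩ := hcase
    have hpA : y * p ∈ A := by simpa [hI, mul_comm] using hp
    exact hv ⟨_, hpA⟩ (hcontr _ hprime p hp y ⟨_, hpA⟩ rfl) rfl

open Polynomial in
/-- If `z³ = d`, evaluation at `z` reduces every polynomial to one of degree at most two, modulo
`X³ - d`. -/
theorem exists_eq_and_dvd_sub_of_cube {R B : Type*} [CommRing R] [Nontrivial R]
    [CommRing B] [Algebra R B]
    {d : R} {z : B} (hz : z ^ 3 = algebraMap R B d) (M : R[X]) :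
    ∃ a b c : R, aeval z M = algebraMap R B a + algebraMap R B b * z + algebraMap R B c * z ^ 2 ∧
      X ^ 3 - C d ∣
        M - (C a + C b * X + C c * X ^ 2) := by
  have hmon : (X ^ 3 - C d : R[X]).Monic := monic_X_pow_sub_C d three_ne_zero
  have hdeg : (M %ₘ (X ^ 3 - C d)).natDegree < 3 := by
    have := natDegree_modByMonic_lt M hmon (by
      intro h
      have := congrArg natDegree h
      simp at this)
    simpa using this
  have hrep := (M %ₘ (X ^ 3 - C d)).as_sum_range' 3 hdeg
  simp only [Finset.sum_range_succ, Finset.range_zero, Finset.sum_empty, zero_add,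
    ← C_mul_X_pow_eq_monomial, pow_zero, mul_one, pow_one] at hrep
  have hdiv := modByMonic_add_div M (X ^ 3 - C d)
  refine ⟨(M %ₘ (X ^ 3 - C d)).coeff 0, (M %ₘ (X ^ 3 - C d)).coeff 1,
    (M %ₘ (X ^ 3 - C d)).coeff 2, ?_, ?_⟩
  rotate_left
  · rw [← hrep]
    exact ⟨M /ₘ (X ^ 3 - C d), by linear_combination -hdiv⟩
  · conv_lhs => rw [← hdiv, hrep]
    simp [hz]

open Polynomial in
/-- A pure cubic extension `R[d^{1/3}]` of a unique factorization domain containing `1/3` and a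
primitive cube root of unity is integrally closed if `d` is squarefree. -/
theorem exists_eq_of_isIntegral_of_cube_squarefree {R B : Type*} [CommRing R] [IsDomain R]
    [UniqueFactorizationMonoid R] [CommRing B] [IsDomain B] [Algebra R B]
    {d ω : R} {z : B} (hz : z ^ 3 = algebraMap R B d) (hd : Squarefree d) (hd0 : d ≠ 0)
    (hω : ω ^ 2 + ω + 1 = 0) (h3 : IsUnit (3 : R))
    (hind : ∀ a b c : R, algebraMap R B a + algebraMap R B b * z + algebraMap R B c * z ^ 2 = 0 →
      a = 0 ∧ b = 0 ∧ c = 0)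
    {y : B} (hy : IsIntegral R y) {v a b c : R} (hv : v ≠ 0)
    (hvy : algebraMap R B v * y =
      algebraMap R B a + algebraMap R B b * z + algebraMap R B c * z ^ 2) :
    ∃ a' b' c' : R, y =
      algebraMap R B a' + algebraMap R B b' * z + algebraMap R B c' * z ^ 2 := by
  have hinj : Function.Injective (algebraMap R B) := by
    rw [injective_iff_map_eq_zero]
    intro r hr
    exact (hind r 0 0 (by simp [hr])).1
  let K := FractionRing B
  let ι : B →+* K := algebraMap B K
  have hι : Function.Injective ι := IsFractionRing.injective B K
  let f : R →+* K := algebraMap R K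
  have hf : ∀ r, f r = ι (algebraMap R B r) := fun r => IsScalarTower.algebraMap_apply R B K r
  have hfinj : Function.Injective f := fun r s h => hinj (hι (by simpa [hf] using h))
  have hfv : f v ≠ 0 := fun h => hv (hfinj (by simpa using h))
  have hω3 : ω ^ 3 = 1 := by linear_combination (ω - 1) * hω
  set Z : K := ι z with hZ
  have hZ3 : Z ^ 3 = f d := by rw [hZ, ← map_pow, hz, hf]
  have hZ0 : Z ≠ 0 := by
    intro h
    rw [h] at hZ3
    exact hd0 (hfinj (by simpa using hZ3.symm))
  -- conjugates of `y` are integral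
  have hconj : ∀ η : R, η ^ 3 = 1 →
      IsIntegral R ((f a + f b * (f η * Z) + f c * (f η * Z) ^ 2) / f v) := by
    intro η hη
    obtain ⟨m, hm, hmy⟩ := hy
    let G : R[X] := C a + C b * X + C c * X ^ 2
    let M : R[X] := (scaleRoots m v).eval₂ C G
    have hM : aeval z M = 0 := by
      change (aeval z : R[X] →ₐ[R] B).toRingHom ((scaleRoots m v).eval₂ C G) = 0
      rw [hom_eval₂]
      have h1 : (aeval z : R[X] →ₐ[R] B).toRingHom.comp C = algebraMap R B := by
        ext r; simp
      have h2 : (aeval z : R[X] →ₐ[R] B).toRingHom G = algebraMap R B v * y := by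
        simp [G, hvy]
      rw [h1, h2, scaleRoots_eval₂_mul, hmy, mul_zero]
    obtain ⟨a₁, b₁, c₁, h1, h2⟩ := exists_eq_and_dvd_sub_of_cube hz M
    obtain ⟨rfl, rfl, rfl⟩ := hind _ _ _ (h1.symm.trans hM)
    obtain ⟨Q, hQ⟩ : X ^ 3 - C d ∣ M := by simpa using h2
    let T : R[X] →+* K := eval₂RingHom f (f η * Z)
    have hT0 : T M = 0 := by
      rw [hQ, map_mul]
      have : T (X ^ 3 - C d) = 0 := by
        simp [T, mul_pow, ← map_pow, hη, ← hZ3]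
      rw [this, zero_mul]
    refine ⟨m, hm, ?_⟩
    change T ((scaleRoots m v).eval₂ C G) = 0 at hT0
    rw [hom_eval₂] at hT0
    have h3 : T.comp C = f := by ext r; simp [T]
    have h4 : T G = f v * ((f a + f b * (f η * Z) + f c * (f η * Z) ^ 2) / f v) := by
      rw [mul_div_cancel₀ _ hfv]; simp [T, G]
    rw [h3, h4, scaleRoots_eval₂_mul] at hT0
    exact (mul_eq_zero.1 hT0).resolve_left (pow_ne_zero _ hfv)
  have h3' : f 3 ≠ 0 := fun h => h3.ne_zero (hfinj (by simpa using h))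
  obtain ⟨t, ht⟩ := h3.exists_left_inv
  have ht' : f t * 3 = 1 := by
    have := congrArg f ht; simpa only [map_mul, map_one, map_ofNat] using this
  have hfω : f ω ^ 2 + f ω + 1 = 0 := by
    have := congrArg f hω; simpa using this
  have i1 := hconj 1 (one_pow 3)
  have i2 := hconj ω hω3
  have i3 := hconj (ω ^ 2) (by rw [← pow_mul, mul_comm, pow_mul, hω3, one_pow])
  have hfi : ∀ r : R, IsIntegral R (f r) := fun r => isIntegral_algebraMap
  have hcongr : ∀ {u w : K}, IsIntegral R u → w = u → IsIntegral R w := fun h e => e ▸ h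
  have ia : IsIntegral R (f a / f v) := by
    refine hcongr ((hfi t).mul ((i1.add i2).add i3)) ?_
    simp only [map_one, map_pow]
    linear_combination (-f a / f v) * ht' -
      (f t * f b * Z + f t * f c * Z ^ 2 * (1 - f ω + f ω ^ 2)) / f v * hfω
  have ib : IsIntegral R (f b * Z / f v) := by
    refine hcongr ((hfi t).mul ((i1.add ((hfi (ω ^ 2)).mul i2)).add ((hfi ω).mul i3))) ?_
    simp only [map_one, map_pow]
    linear_combination (-f b * Z / f v) * ht' -
      (f t * f a + 2 * f t * f b * Z * (f ω - 1) +
        f t * f c * Z ^ 2 * (f ω ^ 3 - f ω + 1)) / f v * hfω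
  have ic : IsIntegral R (f c * Z ^ 2 / f v) := by
    refine hcongr ((hfi t).mul ((i1.add ((hfi ω).mul i2)).add ((hfi (ω ^ 2)).mul i3))) ?_
    simp only [map_one, map_pow]
    linear_combination (-f c * Z ^ 2 / f v) * ht' -
      (f t * f a + f t * f b * Z * (1 - f ω + f ω ^ 2) +
        f t * f c * Z ^ 2 * (f ω - 1) * (f ω ^ 3 + 2)) / f v * hfω
  have hdvd : ∀ r w : R, w ≠ 0 → IsIntegral R (f r / f w) → ∃ s, r = w * s := by
    intro r w hw hrw
    have : FaithfulSMul R K := (faithfulSMul_iff_algebraMap_injective R K).2 hfinj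
    let _ : Algebra (FractionRing R) K := FractionRing.liftAlgebra R K
    have hw' : f w ≠ 0 := fun h => hw (hfinj (by simpa using h))
    have e : f r / f w = algebraMap (FractionRing R) K
        (algebraMap R (FractionRing R) r / algebraMap R (FractionRing R) w) := by
      rw [map_div₀, ← IsScalarTower.algebraMap_apply, ← IsScalarTower.algebraMap_apply]
    rw [e, isIntegral_algebraMap_iff (algebraMap (FractionRing R) K).injective] at hrw
    obtain ⟨s, hs⟩ := IsIntegrallyClosed.isIntegral_iff.1 hrw
    refine ⟨s, IsFractionRing.injective R (FractionRing R) ?_⟩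
    have hw'' : algebraMap R (FractionRing R) w ≠ 0 := by simpa using hw
    rw [map_mul, hs, mul_div_cancel₀ _ hw'']
  have iZ : IsIntegral R Z := IsIntegral.of_pow three_pos (hZ3 ▸ hfi d)
  have hv3 : v ^ 3 ≠ 0 := pow_ne_zero 3 hv
  have hdiv : ∀ r s : R, r * d = v * s → d ∣ s ^ 3 → ∃ s', r = v * s' := by
    intro r s hrs hds
    obtain ⟨s', rfl⟩ := (hd.dvd_pow_iff_dvd three_ne_zero).1 hds
    exact ⟨s', mul_right_cancel₀ hd0 (by linear_combination hrs)⟩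
  obtain ⟨a', ha'⟩ := hdvd a v hv ia
  obtain ⟨b', hb'⟩ : ∃ b', b = v * b' := by
    obtain ⟨s, hs⟩ := hdvd (b * d) v hv (by
      refine hcongr (ib.mul (iZ.pow 2)) ?_
      rw [map_mul, ← hZ3]
      ring)
    obtain ⟨r, hr⟩ := hdvd (b ^ 3 * d) (v ^ 3) hv3 (by
      refine hcongr (ib.pow 3) ?_
      rw [map_mul, ← hZ3, map_pow, map_pow]
      ring)
    refine hdiv b s hs ⟨d * r, mul_left_cancel₀ hv3 ?_⟩
    linear_combination d ^ 2 * hr - ((b * d) ^ 2 + b * d * (v * s) + (v * s) ^ 2) * hs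
  obtain ⟨c', hc'⟩ : ∃ c', c = v * c' := by
    obtain ⟨s, hs⟩ := hdvd (c * d) v hv (by
      refine hcongr (ic.mul iZ) ?_
      rw [map_mul, ← hZ3]
      ring)
    obtain ⟨r, hr⟩ := hdvd (c ^ 3 * d ^ 2) (v ^ 3) hv3 (by
      refine hcongr (ic.pow 3) ?_
      rw [map_mul, map_pow, map_pow f d, ← hZ3, map_pow]
      ring)
    refine hdiv c s hs ⟨r, mul_left_cancel₀ hv3 ?_⟩
    linear_combination d * hr - ((c * d) ^ 2 + c * d * (v * s) + (v * s) ^ 2) * hs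
  have hbv : algebraMap R B v ≠ 0 := fun h => hv (hinj (by simpa using h))
  refine ⟨a', b', c', mul_left_cancel₀ hbv ?_⟩
  rw [hvy, ha', hb', hc']
  simp only [map_mul]
  ring

open Polynomial in
theorem map_aevalAeval {k B B' : Type*} [CommRing k] [CommRing B] [Algebra k B]
    [CommRing B'] [Algebra k B'] (g : B →ₐ[k] B') (u v : B) (r : k[X][X]) :
    g (aevalAeval u v r) = aevalAeval (g u) (g v) r := by
  have : g.comp (aevalAeval u v) = aevalAeval (g u) (g v) :=
    (aevalAevalEquiv k B').symm.injective (by simp)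
  exact DFunLike.congr_fun this r

open Polynomial in
theorem eq_zero_of_aevalAeval_eq_zero {r : ℂ[X][X]} (h : ∀ u v : ℂ, aevalAeval u v r = 0) :
    r = 0 := by
  ext1 n
  rw [coeff_zero]
  refine Polynomial.funext fun u => ?_
  have : r.map (evalRingHom u) = 0 := Polynomial.funext fun v => by
    have := h u v
    rw [coe_aevalAeval_eq_evalEval, ← eval₂_evalRingHom] at this
    rw [eval_map, this, eval_zero]
  simpa using congrArg (fun p => p.coeff n) this

open Polynomial in
/-- `1 - x³ - y³` in the coordinates `e = x + y` (the inner variable) and `x` (the outer one). -/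
noncomputable def fermatDisc : ℂ[X][X] :=
  1 - X ^ 3 - (C X - X) ^ 3

open Polynomial in
theorem fermatDisc_eq :
    fermatDisc = C (-3 * X) * X ^ 2 + C (3 * X ^ 2) * X + C (1 - X ^ 3) := by
  simp only [fermatDisc, map_mul, map_neg, map_ofNat, map_sub, map_one, map_pow]
  ring

open Polynomial in
theorem natDegree_fermatDisc : fermatDisc.natDegree = 2 := by
  rw [fermatDisc_eq, natDegree_quadratic]
  exact mul_ne_zero (by norm_num) X_ne_zero

theorem fermatDisc_ne_zero : fermatDisc ≠ 0 := by
  intro h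
  have := natDegree_fermatDisc
  simp [h] at this

open Polynomial in
theorem squarefree_fermatDisc : Squarefree fermatDisc := by
  rintro p ⟨c, hc⟩
  have hder : p ∣ derivative fermatDisc := by
    rw [hc]
    simp only [derivative_mul]
    exact ⟨derivative p * c + derivative p * c + p * derivative c, by ring⟩
  have hdisc : p ∣ C (12 * X - 3 * X ^ 4) := by
    have e : (C (12 * X - 3 * X ^ 4) : ℂ[X][X]) =
        derivative fermatDisc ^ 2 + 12 * C X * fermatDisc := by
      rw [fermatDisc_eq]
      simp only [derivative_add, derivative_mul, derivative_C, derivative_X, derivative_X_pow]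
      simp only [map_mul, map_neg, map_ofNat, map_sub, map_one, map_pow]
      push_cast
      simp only [map_ofNat]
      ring
    rw [e]
    exact dvd_add (dvd_pow hder two_ne_zero) (Dvd.dvd.mul_left ⟨p * c, by rw [hc]; ring⟩ _)
  have hne : (12 * X - 3 * X ^ 4 : ℂ[X]) ≠ 0 := fun h => by
    have := congrArg (eval 1) h
    norm_num at this
  have hdeg := natDegree_le_of_dvd hdisc (C_ne_zero.2 hne)
  rw [natDegree_C, Nat.le_zero, natDegree_eq_zero] at hdeg
  obtain ⟨q, rfl⟩ := hdeg
  have hq : C q ∣ fermatDisc := ⟨C q * c, by rw [hc]; ring⟩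
  have hcoeff : ∀ u v w : ℂ[X], C q ∣ C u * X ^ 2 + C v * X + C w → q ∣ w ∧ q ∣ u := by
    intro u v w h
    rw [C_dvd_iff_dvd_coeff] at h
    exact ⟨by simpa using h 0, by simpa [coeff_X, coeff_C] using h 2⟩
  rw [fermatDisc_eq] at hq
  obtain ⟨h0, h2⟩ := hcoeff _ _ _ hq
  have h3 : q ∣ C 3 := by
    have e : (C 3 : ℂ[X]) = 3 * (1 - X ^ 3) - X ^ 2 * (-3 * X) := by
      simp only [map_ofNat]; ring
    rw [e]
    exact dvd_sub (h0.mul_left _) (h2.mul_left _)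
  exact (isUnit_of_dvd_unit h3 (isUnit_C.2 (by norm_num))).map C

open Polynomial in
/-- The norm form of a pure cubic extension by the cube root of a polynomial `d` of degree two
only represents constants by constants. -/
theorem eq_zero_of_natDegree_cubic_norm_eq_zero {D : Type*} [CommRing D] [IsDomain D]
    {d a b c : D[X]}
    (hd : d.natDegree = 2)
    (h : (a ^ 3 + b ^ 3 * d + c ^ 3 * d ^ 2 - 3 * (a * b * c * d)).natDegree = 0) :
    b = 0 ∧ c = 0 ∧ a.natDegree = 0 := by
  have hd0 : d ≠ 0 := by rintro rfl; simp at hd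
  have hA : (a ^ 3).natDegree = 3 * a.natDegree := natDegree_pow a 3
  have hB : b ≠ 0 → (b ^ 3 * d).natDegree = 3 * b.natDegree + 2 := fun hb => by
    rw [natDegree_mul (pow_ne_zero _ hb) hd0, natDegree_pow, hd]
  have hC : c ≠ 0 → (c ^ 3 * d ^ 2).natDegree = 3 * c.natDegree + 4 := fun hc => by
    rw [natDegree_mul (pow_ne_zero _ hc) (pow_ne_zero _ hd0), natDegree_pow, natDegree_pow, hd]
  have hS : (3 * (a * b * c * d)).natDegree ≤ (a * b * c * d).natDegree := by
    have : (3 : D[X]) = C 3 := (map_ofNat C 3).symm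
    rw [this]
    exact natDegree_C_mul_le _ _
  have hS0 : a = 0 ∨ b = 0 ∨ c = 0 → (a * b * c * d).natDegree = 0 := by
    rintro (rfl | rfl | rfl) <;> simp
  have hS1 : a ≠ 0 → b ≠ 0 → c ≠ 0 →
      (a * b * c * d).natDegree = a.natDegree + b.natDegree + c.natDegree + 2 := by
    intro ha hb hc
    rw [natDegree_mul (mul_ne_zero (mul_ne_zero ha hb) hc) hd0,
      natDegree_mul (mul_ne_zero ha hb) hc, natDegree_mul ha hb, hd]
  have hB0 : b = 0 → (b ^ 3 * d).natDegree = 0 := by rintro rfl; simp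
  have hC0 : c = 0 → (c ^ 3 * d ^ 2).natDegree = 0 := by rintro rfl; simp
  have key : ∀ p q r s : D[X], q.natDegree < p.natDegree → r.natDegree < p.natDegree →
      s.natDegree < p.natDegree → (p + q + r - s).natDegree = p.natDegree := by
    intro p q r s hq hr hs
    have e : p + q + r - s = p + (q + r - s) := by ring
    rw [e, natDegree_add_eq_left_of_natDegree_lt]
    refine lt_of_le_of_lt (natDegree_sub_le _ _) (max_lt ?_ hs)
    exact lt_of_le_of_lt (natDegree_add_le _ _) (max_lt hq hr)
  have kA := key (a ^ 3) (b ^ 3 * d) (c ^ 3 * d ^ 2) (3 * (a * b * c * d))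
  have kB := key (b ^ 3 * d) (a ^ 3) (c ^ 3 * d ^ 2) (3 * (a * b * c * d))
  have kC := key (c ^ 3 * d ^ 2) (a ^ 3) (b ^ 3 * d) (3 * (a * b * c * d))
  rw [add_comm (b ^ 3 * d) (a ^ 3)] at kB
  rw [show c ^ 3 * d ^ 2 + a ^ 3 + b ^ 3 * d = a ^ 3 + b ^ 3 * d + c ^ 3 * d ^ 2 by ring] at kC
  by_cases hb : b = 0 <;> by_cases hc : c = 0 <;> by_cases ha : a = 0 <;>
    simp only [hb, hc, ha, ne_eq, not_true_eq_false, not_false_eq_true, true_or, or_true, false_or,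
      forall_const, IsEmpty.forall_iff, true_and, false_and, natDegree_zero] at * <;> omega

open Polynomial in
theorem pow_three_eq_aevalAeval_fermatDisc {B : Type*} [CommRing B] [Algebra ℂ B] {x y z : B}
    (hS : x ^ 3 + y ^ 3 + z ^ 3 = 1) : z ^ 3 = aevalAeval (x + y) x fermatDisc := by
  have : aevalAeval (x + y) x fermatDisc = 1 - x ^ 3 - (x + y - x) ^ 3 := by
    simp [fermatDisc]
  rw [this]
  linear_combination hS

open Polynomial in
theorem eq_zero_of_fermat_combination_eq_zero {B : Type*} [CommRing B] [Algebra ℂ B] {x y z : B}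
    (hsurj : ∀ u v w : ℂ, u ^ 3 + v ^ 3 + w ^ 3 = 1 →
      ∃ ε : B →ₐ[ℂ] ℂ, ε x = u ∧ ε y = v ∧ ε z = w)
    {a b c : ℂ[X][X]} (h : aevalAeval (x + y) x a + aevalAeval (x + y) x b * z +
      aevalAeval (x + y) x c * z ^ 2 = 0) : a = 0 ∧ b = 0 ∧ c = 0 := by
  obtain ⟨ω, hω⟩ : ∃ ω : ℂ, ω ^ 2 + ω + 1 = 0 := by
    obtain ⟨s, hs⟩ := IsAlgClosed.exists_pow_nat_eq (-3 : ℂ) two_pos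
    exact ⟨(-1 + s) / 2, by linear_combination hs / 4⟩
  have hω3 : ω ^ 3 = 1 := by linear_combination (ω - 1) * hω
  have key : ∀ u v w : ℂ, w ^ 3 = aevalAeval u v fermatDisc →
      aevalAeval u v a + aevalAeval u v b * w + aevalAeval u v c * w ^ 2 = 0 := by
    intro u v w hw
    obtain ⟨ε, hx, hy, hz⟩ := hsurj v (u - v) w (by rw [hw]; simp [fermatDisc])
    have := congrArg ε h
    simpa only [map_add, map_mul, map_pow, map_aevalAeval, hx, hy, hz, add_sub_cancel,
      map_zero] using this
  have main : ∀ u v : ℂ, aevalAeval u v a = 0 ∧ aevalAeval u v (b * fermatDisc) = 0 ∧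
      aevalAeval u v (c * fermatDisc) = 0 := by
    intro u v
    obtain ⟨w, hw⟩ := IsAlgClosed.exists_pow_nat_eq (aevalAeval u v fermatDisc) three_pos
    have h0 := key u v w hw
    have h1 := key u v (ω * w) (by rw [mul_pow, hω3, hw, one_mul])
    have h2 := key u v (ω ^ 2 * w) (by
      rw [mul_pow, ← pow_mul, mul_comm 2 3, pow_mul, hω3, hw, one_pow, one_mul])
    simp only [map_mul, ← hw]
    generalize aevalAeval u v a = a at *
    generalize aevalAeval u v b = b at *
    generalize aevalAeval u v c = c at *
    have e1 : a = 0 := by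
      linear_combination (h0 + h1 + h2) / 3 - (b * w + c * w ^ 2 * (1 - ω + ω ^ 2)) / 3 * hω
    have e2 : b * w = 0 := by
      linear_combination (h0 + ω ^ 2 * h1 + ω * h2) / 3 -
        (a + 2 * b * w * (ω - 1) + c * w ^ 2 * (ω ^ 3 - ω + 1)) / 3 * hω
    have e3 : c * w ^ 2 = 0 := by
      linear_combination (h0 + ω * h1 + ω ^ 2 * h2) / 3 -
        (a + b * w * (1 - ω + ω ^ 2) + c * w ^ 2 * (ω - 1) * (ω ^ 3 + 2)) / 3 * hω
    exact ⟨e1, by linear_combination w ^ 2 * e2, by linear_combination w * e3⟩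
  refine ⟨eq_zero_of_aevalAeval_eq_zero fun u v => (main u v).1, ?_, ?_⟩
  · exact (mul_eq_zero.1 (eq_zero_of_aevalAeval_eq_zero fun u v => (main u v).2.1)).resolve_right
      fermatDisc_ne_zero
  · exact (mul_eq_zero.1 (eq_zero_of_aevalAeval_eq_zero fun u v => (main u v).2.2)).resolve_right
      fermatDisc_ne_zero

open Polynomial in
theorem irreducible_add_of_fermat_combinations {B : Type*} [CommRing B] [Algebra ℂ B] {x y z : B}
    (hS : x ^ 3 + y ^ 3 + z ^ 3 = 1)
    (hsurj : ∀ u v w : ℂ, u ^ 3 + v ^ 3 + w ^ 3 = 1 →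
      ∃ ε : B →ₐ[ℂ] ℂ, ε x = u ∧ ε y = v ∧ ε z = w)
    (hform : ∀ t : B, ∃ a b c : ℂ[X][X], t = aevalAeval (x + y) x a +
      aevalAeval (x + y) x b * z + aevalAeval (x + y) x c * z ^ 2) :
    Irreducible (x + y) := by
  have hz := pow_three_eq_aevalAeval_fermatDisc hS
  refine ⟨fun hu => ?_, fun g h hgh => ?_⟩
  · obtain ⟨ε, hx, hy, -⟩ := hsurj 0 0 1 (by norm_num)
    have := hu.map ε
    simp [hx, hy] at this
  obtain ⟨a, b, c, rfl⟩ := hform g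
  obtain ⟨a', b', c', rfl⟩ := hform h
  have hX : x + y = aevalAeval (x + y) x (C X : ℂ[X][X]) := by simp
  obtain ⟨h1, h2, h3⟩ := eq_zero_of_fermat_combination_eq_zero hsurj
    (a := a * a' + fermatDisc * (b * c' + c * b') - C X)
    (b := a * b' + b * a' + fermatDisc * (c * c')) (c := a * c' + b * b' + c * a') (by
      have hgh' := hX.symm.trans hgh
      simp only [map_add, map_sub, map_mul, ← hz]
      linear_combination -hgh')
  have hN : (a ^ 3 + b ^ 3 * fermatDisc + c ^ 3 * fermatDisc ^ 2 - 3 * (a * b * c * fermatDisc)) *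
      (a' ^ 3 + b' ^ 3 * fermatDisc + c' ^ 3 * fermatDisc ^ 2 - 3 * (a' * b' * c' * fermatDisc)) =
      C (X ^ 3) := by
    rw [map_pow]
    generalize (C X : ℂ[X][X]) = T at *
    linear_combination ((a * a' + fermatDisc * (b * c' + c * b')) ^ 2 +
      (a * a' + fermatDisc * (b * c' + c * b')) * T + T ^ 2) * h1 +
      ((a * b' + b * a' + fermatDisc * (c * c')) ^ 2 * fermatDisc -
        3 * (a * a' + fermatDisc * (b * c' + c * b')) * (a * c' + b * b' + c * a') *
          fermatDisc) * h2 + (a * c' + b * b' + c * a') ^ 2 * fermatDisc ^ 2 * h3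
  have hN0 : (C (X ^ 3) : ℂ[X][X]) ≠ 0 := C_ne_zero.2 (pow_ne_zero 3 X_ne_zero)
  have hdeg := congrArg natDegree hN
  rw [natDegree_mul (left_ne_zero_of_mul (hN ▸ hN0)) (right_ne_zero_of_mul (hN ▸ hN0)),
    natDegree_C, Nat.add_eq_zero_iff] at hdeg
  obtain ⟨rfl, rfl, ha⟩ := eq_zero_of_natDegree_cubic_norm_eq_zero natDegree_fermatDisc hdeg.1
  obtain ⟨rfl, rfl, ha'⟩ := eq_zero_of_natDegree_cubic_norm_eq_zero natDegree_fermatDisc hdeg.2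
  obtain ⟨a, rfl⟩ := natDegree_eq_zero.1 ha
  obtain ⟨a', rfl⟩ := natDegree_eq_zero.1 ha'
  have haa : X = a * a' := C_injective (by rw [map_mul]; linear_combination -h1)
  simp only [map_zero, zero_mul, add_zero]
  exact (irreducible_X.isUnit_or_isUnit haa).imp (fun h => (h.map C).map _)
    fun h => (h.map C).map _

open Polynomial in
theorem not_irreducible_add_of_fermat {B : Type*} [CommRing B] [IsDomain B]
    [UniqueFactorizationMonoid B] [Algebra ℂ B] {x y z : B}
    (hS : x ^ 3 + y ^ 3 + z ^ 3 = 1)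
    (hsurj : ∀ u v w : ℂ, u ^ 3 + v ^ 3 + w ^ 3 = 1 →
      ∃ ε : B →ₐ[ℂ] ℂ, ε x = u ∧ ε y = v ∧ ε z = w) : ¬ Irreducible (x + y) := by
  intro hirr
  obtain ⟨ω, hω⟩ : ∃ ω : ℂ, ω ^ 2 + ω + 1 = 0 := by
    obtain ⟨s, hs⟩ := IsAlgClosed.exists_pow_nat_eq (-3 : ℂ) two_pos
    exact ⟨(-1 + s) / 2, by linear_combination hs / 4⟩
  have hdvd : x + y ∣ (1 - z) * (1 + z + z ^ 2) :=
    ⟨x ^ 2 - x * y + y ^ 2, by linear_combination -hS⟩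
  rcases hirr.prime.dvd_or_dvd hdvd with ⟨t, ht⟩ | ⟨t, ht⟩
  · obtain ⟨ε, hx, hy, hz⟩ := hsurj 0 0 ω (by linear_combination (ω - 1) * hω)
    have := congrArg ε ht
    simp only [map_sub, map_one, map_mul, map_add, hx, hy, hz] at this
    have : (3 : ℂ) = 0 := by linear_combination (ω + 2) * this + hω
    norm_num at this
  · obtain ⟨ε, hx, hy, hz⟩ := hsurj 0 0 1 (by norm_num)
    have := congrArg ε ht
    simp only [map_pow, map_one, map_mul, map_add, hx, hy, hz] at this
    norm_num at this

open Polynomial in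
theorem exists_aeval_eq_fermat_combination {B : Type*} [CommRing B] [Algebra ℂ B] {x y z : B}
    (hS : x ^ 3 + y ^ 3 + z ^ 3 = 1) (m : MvPolynomial (Fin 3) ℂ) :
    ∃ a b c : ℂ[X][X], MvPolynomial.aeval ![x, y, z] m = aevalAeval (x + y) x a +
      aevalAeval (x + y) x b * z + aevalAeval (x + y) x c * z ^ 2 := by
  have hz := pow_three_eq_aevalAeval_fermatDisc hS
  induction m using MvPolynomial.induction_on with
  | C r => exact ⟨C (C r), 0, 0, by simp⟩
  | add p q hp hq =>
    obtain ⟨a, b, c, hp⟩ := hp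
    obtain ⟨a', b', c', hq⟩ := hq
    refine ⟨a + a', b + b', c + c', ?_⟩
    simp only [map_add, hp, hq]
    ring
  | mul_X p i hp =>
    obtain ⟨a, b, c, hp⟩ := hp
    rw [map_mul, hp, MvPolynomial.aeval_X]
    fin_cases i
    · refine ⟨a * X, b * X, c * X, ?_⟩
      simp
      ring
    · refine ⟨a * (C X - X), b * (C X - X), c * (C X - X), ?_⟩
      simp
      ring
    · refine ⟨fermatDisc * c, a, b, ?_⟩
      simp only [map_mul, ← hz]
      simp
      ring

open Polynomial in
theorem aevalAeval_mem_range_aeval {B : Type*} [CommRing B] [Algebra ℂ B] (x y z : B)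
    (r : ℂ[X][X]) :
    aevalAeval (x + y) x r ∈ (MvPolynomial.aeval (R := ℂ) ![x, y, z]).range := by
  refine ⟨aevalAeval (MvPolynomial.X 0 + MvPolynomial.X 1) (MvPolynomial.X 0) r, ?_⟩
  change MvPolynomial.aeval ![x, y, z] _ = _
  rw [map_aevalAeval]
  simp

open Polynomial in
theorem mem_range_aeval_of_isIntegral_of_fermat {B : Type*} [CommRing B] [IsDomain B]
    [Algebra ℂ B] {x y z : B}
    (hS : x ^ 3 + y ^ 3 + z ^ 3 = 1)
    (hsurj : ∀ u v w : ℂ, u ^ 3 + v ^ 3 + w ^ 3 = 1 →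
      ∃ ε : B →ₐ[ℂ] ℂ, ε x = u ∧ ε y = v ∧ ε z = w)
    (hfrac : ∀ t : B, ∃ a ∈ (MvPolynomial.aeval (R := ℂ) ![x, y, z]).range, a ≠ 0 ∧
      a * t ∈ (MvPolynomial.aeval (R := ℂ) ![x, y, z]).range)
    {t : B} (ht : IsIntegral (MvPolynomial.aeval (R := ℂ) ![x, y, z]).range t) :
    t ∈ (MvPolynomial.aeval (R := ℂ) ![x, y, z]).range := by
  let φ : ℂ[X][X] →ₐ[ℂ] B := aevalAeval (x + y) x
  let _ : Algebra ℂ[X][X] B := φ.toRingHom.toAlgebra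
  have hφ : ∀ r, algebraMap ℂ[X][X] B r = aevalAeval (x + y) x r := fun _ => rfl
  have hz := pow_three_eq_aevalAeval_fermatDisc hS
  have hzint : IsIntegral ℂ[X][X] z :=
    IsIntegral.of_pow three_pos (hz ▸ isIntegral_algebraMap (x := fermatDisc))
  have hzA : z ∈ (MvPolynomial.aeval (R := ℂ) ![x, y, z]).range := ⟨MvPolynomial.X 2, by simp⟩
  have hmem : ∀ a b c : ℂ[X][X], aevalAeval (x + y) x a + aevalAeval (x + y) x b * z +
      aevalAeval (x + y) x c * z ^ 2 ∈ (MvPolynomial.aeval (R := ℂ) ![x, y, z]).range :=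
    fun a b c => add_mem (add_mem (aevalAeval_mem_range_aeval x y z a)
      (mul_mem (aevalAeval_mem_range_aeval x y z b) hzA))
      (mul_mem (aevalAeval_mem_range_aeval x y z c) (pow_mem hzA 2))
  have htint : IsIntegral ℂ[X][X] t := by
    have hle : ∀ a ∈ (MvPolynomial.aeval (R := ℂ) ![x, y, z]).range,
        a ∈ integralClosure ℂ[X][X] B := by
      rintro _ ⟨m, rfl⟩
      obtain ⟨a, b, c, h⟩ := exists_aeval_eq_fermat_combination hS m
      change MvPolynomial.aeval ![x, y, z] m ∈ _
      rw [h]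
      simp only [← hφ]
      exact (isIntegral_algebraMap.add (isIntegral_algebraMap.mul hzint)).add
        (isIntegral_algebraMap.mul (hzint.pow 2))
    have : IsIntegral (integralClosure ℂ[X][X] B) t :=
      ht.map_of_comp_eq (T := integralClosure ℂ[X][X] B)
        ((algebraMap (MvPolynomial.aeval (R := ℂ) ![x, y, z]).range B).codRestrict _
          fun a => hle a a.2) (RingHom.id B) rfl
    exact isIntegral_trans t this
  obtain ⟨ω, hω⟩ : ∃ ω : ℂ, ω ^ 2 + ω + 1 = 0 := by
    obtain ⟨s, hs⟩ := IsAlgClosed.exists_pow_nat_eq (-3 : ℂ) two_pos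
    exact ⟨(-1 + s) / 2, by linear_combination hs / 4⟩
  obtain ⟨_, ⟨m, rfl⟩, hm0, m', hm'⟩ := hfrac t
  change MvPolynomial.aeval ![x, y, z] m ≠ 0 at hm0
  change MvPolynomial.aeval ![x, y, z] m' = MvPolynomial.aeval ![x, y, z] m * t at hm'
  obtain ⟨a, b, c, h⟩ := exists_aeval_eq_fermat_combination hS m
  obtain ⟨n, hn⟩ : aevalAeval (x + y) x (a ^ 2 - b * c * fermatDisc) +
      aevalAeval (x + y) x (c ^ 2 * fermatDisc - a * b) * z +
      aevalAeval (x + y) x (b ^ 2 - a * c) * z ^ 2 ∈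
        (MvPolynomial.aeval (R := ℂ) ![x, y, z]).range :=
    hmem _ _ _
  change MvPolynomial.aeval ![x, y, z] n = _ at hn
  obtain ⟨a₁, b₁, c₁, h₁⟩ := exists_aeval_eq_fermat_combination hS (m' * n)
  obtain ⟨a₂, b₂, c₂, rfl⟩ := exists_eq_of_isIntegral_of_cube_squarefree
    (ω := (C (C ω) : ℂ[X][X])) hz squarefree_fermatDisc fermatDisc_ne_zero
    (by rw [← map_pow, ← map_pow, ← map_add, ← map_add, ← C_1, ← C_1, ← map_add, ← map_add, hω,
          map_zero, map_zero])
    (by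
      rw [show (3 : ℂ[X][X]) = C (C 3) by simp only [map_ofNat]]
      exact (IsUnit.mk0 (3 : ℂ) (by norm_num)).map (C.comp C))
    (fun a b c h => eq_zero_of_fermat_combination_eq_zero hsurj h) htint
    (v := a ^ 3 + b ^ 3 * fermatDisc + c ^ 3 * fermatDisc ^ 2 - 3 * (a * b * c * fermatDisc))
    (a := a₁) (b := b₁) (c := c₁)
    (by
      intro hv
      obtain ⟨rfl, rfl, -⟩ := eq_zero_of_natDegree_cubic_norm_eq_zero (a := a) (b := b) (c := c)
        natDegree_fermatDisc (by rw [hv, natDegree_zero])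
      have ha : a = 0 := by simpa using hv
      exact hm0 (by simp [h, ha]))
    (by
      simp only [hφ]
      rw [← h₁, map_mul, hm', h, hn]
      simp only [map_add, map_sub, map_mul, map_pow, ← hz, map_ofNat]
      ring)
  exact hmem _ _ _

theorem range_aeval_eq_top_of_fermat {B : Type*} [CommRing B] [IsDomain B] [Algebra ℂ B]
    {x y z : B} (hS : x ^ 3 + y ^ 3 + z ^ 3 = 1)
    (hsurj : ∀ u v w : ℂ, u ^ 3 + v ^ 3 + w ^ 3 = 1 →
      ∃ ε : B →ₐ[ℂ] ℂ, ε x = u ∧ ε y = v ∧ ε z = w)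
    (hfrac : ∀ t : B, ∃ a ∈ (MvPolynomial.aeval (R := ℂ) ![x, y, z]).range, a ≠ 0 ∧
      a * t ∈ (MvPolynomial.aeval (R := ℂ) ![x, y, z]).range) :
    (MvPolynomial.aeval (R := ℂ) ![x, y, z]).range = ⊤ := by
  have : IsNoetherianRing (MvPolynomial.aeval (R := ℂ) ![x, y, z]).range :=
    isNoetherianRing_range (MvPolynomial.aeval (R := ℂ) ![x, y, z]).toRingHom
  refine Subalgebra.eq_top_of_isIntegrallyClosedIn_of_contracted_primes _
    (fun t ht => mem_range_aeval_of_isIntegral_of_fermat hS hsurj hfrac ht) hfrac ?_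
  intro P hP p hp t u hu
  let π := (MvPolynomial.aeval (R := ℂ) ![x, y, z]).rangeRestrict
  have hπ : ∀ m : MvPolynomial (Fin 3) ℂ, (π m : B) = MvPolynomial.aeval ![x, y, z] m :=
    fun _ => rfl
  obtain ⟨p, rfl⟩ := (MvPolynomial.aeval (R := ℂ) ![x, y, z]).rangeRestrict_surjective p
  obtain ⟨u, rfl⟩ := (MvPolynomial.aeval (R := ℂ) ![x, y, z]).rangeRestrict_surjective u
  have hI : (P.comap π).IsPrime := Ideal.IsPrime.comap π
  change u ∈ P.comap π
  rw [← MvPolynomial.IsPrime.vanishingIdeal_zeroLocus (K := ℂ) (P.comap π)]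
  intro s hs
  have hs' : ∀ m ∈ P.comap π, MvPolynomial.aeval s m = 0 :=
    MvPolynomial.mem_zeroLocus_iff.1 hs
  obtain ⟨ε, hx, hy, hz⟩ := hsurj (s 0) (s 1) (s 2) (by
    have := hs' (MvPolynomial.X 0 ^ 3 + MvPolynomial.X 1 ^ 3 + MvPolynomial.X 2 ^ 3 - 1) (by
      have : π (MvPolynomial.X 0 ^ 3 + MvPolynomial.X 1 ^ 3 + MvPolynomial.X 2 ^ 3 - 1) = 0 :=
        Subtype.ext (by simp [hπ, hS])
      rw [Ideal.mem_comap, this]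
      exact P.zero_mem)
    simpa [sub_eq_zero] using this)
  have hε : ∀ m : MvPolynomial (Fin 3) ℂ,
      ε (MvPolynomial.aeval ![x, y, z] m) = MvPolynomial.aeval s m := by
    intro m
    have : ε.comp (MvPolynomial.aeval ![x, y, z]) = MvPolynomial.aeval s := by
      ext i
      fin_cases i <;> simp [hx, hy, hz]
    exact DFunLike.congr_fun this m
  have := congrArg ε hu
  rwa [map_mul, hπ, hπ, hε, hε, hs' p hp, mul_zero] at this

theorem false_of_fermat_parametrization {B : Type*} [CommRing B] [IsDomain B]
    [UniqueFactorizationMonoid B] [Algebra ℂ B]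
    {x y z : B} (hS : x ^ 3 + y ^ 3 + z ^ 3 = 1)
    (hsurj : ∀ u v w : ℂ, u ^ 3 + v ^ 3 + w ^ 3 = 1 →
      ∃ ε : B →ₐ[ℂ] ℂ, ε x = u ∧ ε y = v ∧ ε z = w)
    (hfrac : ∀ t : B, ∃ a ∈ (MvPolynomial.aeval (R := ℂ) ![x, y, z]).range, a ≠ 0 ∧
      a * t ∈ (MvPolynomial.aeval (R := ℂ) ![x, y, z]).range) : False := by
  refine not_irreducible_add_of_fermat hS hsurj
    (irreducible_add_of_fermat_combinations hS hsurj fun t => ?_)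
  obtain ⟨m, rfl⟩ : t ∈ (MvPolynomial.aeval (R := ℂ) ![x, y, z]).range :=
    range_aeval_eq_top_of_fermat hS hsurj hfrac ▸ Algebra.mem_top
  exact exists_aeval_eq_fermat_combination hS m

open MvPolynomial in
theorem isAlgebraic_adjoin_range_of_algebraicIndependent {n : ℕ} {K : Type*} [Field K] [Algebra ℂ K]
    {s : Fin n → K}
    (hK : ∀ k : K, ∃ a b : MvPolynomial (Fin n) ℂ, aeval s b ≠ 0 ∧ k * aeval s b = aeval s a)
    {x : Fin n → K} (hx : AlgebraicIndependent ℂ x) :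
    Algebra.IsAlgebraic (IntermediateField.adjoin ℂ (Set.range x)) K := by
  have hmem : ∀ r : MvPolynomial (Fin n) ℂ, aeval s r ∈ Algebra.adjoin ℂ (Set.range s) := by
    intro r
    rw [Algebra.adjoin_range_eq_range_aeval]
    exact ⟨r, rfl⟩
  have : Algebra.IsAlgebraic (Algebra.adjoin ℂ (Set.range s)) K := by
    refine ⟨fun k => ?_⟩
    obtain ⟨a, b, hb, hab⟩ := hK k
    rw [eq_div_of_mul_eq hb hab, div_eq_mul_inv]
    exact (isAlgebraic_algebraMap (⟨_, hmem a⟩ : Algebra.adjoin ℂ (Set.range s))).mul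
      (isAlgebraic_algebraMap (⟨_, hmem b⟩ : Algebra.adjoin ℂ (Set.range s))).inv
  refine IsTranscendenceBasis.isAlgebraic_field
    (hx.isTranscendenceBasis_of_lift_trdeg_le_of_finite ?_)
  have h1 := Algebra.IsAlgebraic.trdeg_le_cardinalMk (R := ℂ) (Set.range s)
  have h2 : Cardinal.mk (Set.range s) ≤ n := by
    have := Cardinal.mk_range_le_lift (f := s)
    simpa using this
  have := h1.trans h2
  simpa using this

open MvPolynomial in
/-- A rational map which is generically injective on points is birational onto its image. -/
theorem mem_of_generically_injective {n : ℕ} {ι K : Type*} [Field K] [Algebra ℂ K] {s : Fin n → K}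
    (hs : AlgebraicIndependent ℂ s) (L : IntermediateField ℂ K) [Algebra.IsAlgebraic L K]
    {p q : ι → MvPolynomial (Fin n) ℂ} {F : ι → K} (hFL : ∀ i, F i ∈ L)
    (hF : ∀ i, F i * aeval s (q i) = aeval s (p i)) {g : MvPolynomial (Fin n) ℂ} (hg : g ≠ 0)
    (hinj : ∀ v w : Fin n → ℂ, eval v g ≠ 0 → eval w g ≠ 0 →
      (∀ i, eval v (p i) * eval w (q i) = eval w (p i) * eval v (q i)) → v = w) (j : Fin n) :
    s j ∈ L := by
  let Ω := AlgebraicClosure K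
  have : Algebra.IsAlgebraic L Ω := Algebra.IsAlgebraic.trans L K Ω
  have : IsAlgClosure L Ω := ⟨inferInstance, inferInstance⟩
  have : Normal L Ω := IsAlgClosure.normal L Ω
  have : IsGalois L Ω := ⟨⟩
  by_contra hj
  obtain ⟨σ, hσ⟩ : ∃ σ : Gal(Ω/L), σ (algebraMap K Ω (s j)) ≠ algebraMap K Ω (s j) := by
    by_contra! h
    obtain ⟨l, hl⟩ := (InfiniteGalois.mem_range_algebraMap_iff_fixed (k := L) _).2 h
    rw [IsScalarTower.algebraMap_apply L K Ω] at hl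
    exact hj ((algebraMap K Ω).injective hl ▸ l.2)
  let τ : K →ₐ[ℂ] Ω := IsScalarTower.toAlgHom ℂ K Ω
  let τ' : K →ₐ[ℂ] Ω := (σ.toAlgHom.restrictScalars ℂ).comp τ
  have hfix : ∀ i, τ' (F i) = τ (F i) := fun i => σ.commutes ⟨F i, hFL i⟩
  let ψ : MvPolynomial (Fin n ⊕ Fin n) ℂ →ₐ[ℂ] Ω := aeval (Sum.elim (τ ∘ s) (τ' ∘ s))
  have hl : ∀ r, ψ (rename Sum.inl r) = τ (aeval s r) := fun r => by
    rw [comp_aeval_apply, aeval_rename, Sum.elim_comp_inl]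
    rfl
  have hr : ∀ r, ψ (rename Sum.inr r) = τ' (aeval s r) := fun r => by
    rw [comp_aeval_apply, aeval_rename, Sum.elim_comp_inr]
    rfl
  have hgs : aeval s g ≠ 0 := fun h => hg (hs (by simpa using h))
  have hprime : (RingHom.ker ψ).IsPrime := RingHom.ker_isPrime ψ
  obtain ⟨w, hw, hwg⟩ : ∃ w ∈ zeroLocus ℂ (RingHom.ker ψ), aeval w
      (rename Sum.inl g * rename Sum.inr g * (X (Sum.inl j) - X (Sum.inr j))) ≠ 0 := by
    by_contra! h
    have : rename Sum.inl g * rename Sum.inr g * (X (Sum.inl j) - X (Sum.inr j)) ∈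
        vanishingIdeal ℂ (zeroLocus ℂ (RingHom.ker ψ)) := h
    rw [IsPrime.vanishingIdeal_zeroLocus, RingHom.mem_ker, map_mul, map_mul, hl, hr, map_sub,
      mul_eq_zero, mul_eq_zero, map_eq_zero τ, map_eq_zero τ', or_self, or_iff_right hgs] at this
    have hτ : τ (s j) - τ' (s j) = 0 := by simpa [ψ] using this
    exact hσ (sub_eq_zero.1 hτ).symm
  have hwl : ∀ r, aeval w (rename Sum.inl r) = eval (w ∘ Sum.inl) r := fun r => by
    rw [aeval_rename, ← aeval_eq_eval]
  have hwr : ∀ r, aeval w (rename Sum.inr r) = eval (w ∘ Sum.inr) r := fun r => by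
    rw [aeval_rename, ← aeval_eq_eval]
  rw [map_mul, map_mul, hwl, hwr, mul_ne_zero_iff, mul_ne_zero_iff, map_sub, sub_ne_zero,
    aeval_X, aeval_X] at hwg
  refine hwg.2 (congrFun (hinj _ _ hwg.1.1 hwg.1.2 fun i => ?_) j)
  have := mem_zeroLocus_iff.1 hw (rename Sum.inl (p i) * rename Sum.inr (q i) -
    rename Sum.inr (p i) * rename Sum.inl (q i)) (by
      rw [RingHom.mem_ker, map_sub, map_mul, map_mul, hl, hr, hl, hr, ← hF, map_mul, map_mul, hfix]
      ring)
  rwa [map_sub, map_mul, map_mul, hwl, hwr, hwl, hwr, sub_eq_zero] at this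

theorem algebraicIndependent_of_fermat {B : Type*} [CommRing B] [Algebra ℂ B] {x y z : B}
    (hsurj : ∀ u v w : ℂ, u ^ 3 + v ^ 3 + w ^ 3 = 1 →
      ∃ ε : B →ₐ[ℂ] ℂ, ε x = u ∧ ε y = v ∧ ε z = w) : AlgebraicIndependent ℂ ![x, y] := by
  rw [algebraicIndependent_iff]
  intro r hr
  refine MvPolynomial.funext fun u => ?_
  obtain ⟨w, hw⟩ := IsAlgClosed.exists_pow_nat_eq (1 - u 0 ^ 3 - u 1 ^ 3) three_pos
  obtain ⟨ε, hx, hy, -⟩ := hsurj (u 0) (u 1) w (by rw [hw]; ring)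
  have := congrArg ε hr
  rw [MvPolynomial.comp_aeval_apply, map_zero] at this
  rw [map_zero, ← this, ← MvPolynomial.aeval_eq_eval]
  congr 2
  ext i
  fin_cases i <;> simp [hx, hy]

open MvPolynomial in
theorem exists_mul_mem_range_aeval_of_generically_injective {B : Type*} [CommRing B] [IsDomain B]
    [Algebra ℂ B]
    [Algebra (MvPolynomial (Fin 2) ℂ) B] [IsScalarTower ℂ (MvPolynomial (Fin 2) ℂ) B]
    {M : Submonoid (MvPolynomial (Fin 2) ℂ)} (hM : M ≤ nonZeroDivisors (MvPolynomial (Fin 2) ℂ))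
    [IsLocalization M B] {F : Fin 3 → B} (hind : AlgebraicIndependent ℂ ![F 0, F 1])
    {p q : Fin 3 → MvPolynomial (Fin 2) ℂ}
    (hF : ∀ i, algebraMap _ B (q i) * F i = algebraMap _ B (p i))
    {g : MvPolynomial (Fin 2) ℂ} (hg : g ≠ 0)
    (hinj : ∀ v w : Fin 2 → ℂ, eval v g ≠ 0 → eval w g ≠ 0 →
      (∀ i, eval v (p i) * eval w (q i) = eval w (p i) * eval v (q i)) → v = w) (t : B) :
    ∃ a ∈ (aeval (R := ℂ) F).range, a ≠ 0 ∧ a * t ∈ (aeval (R := ℂ) F).range := by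
  have hB : Function.Injective (algebraMap (MvPolynomial (Fin 2) ℂ) B) :=
    IsLocalization.injective B hM
  let K := FractionRing B
  have hBK : Function.Injective (algebraMap B K) := IsFractionRing.injective B K
  let s : Fin 2 → K := fun i => algebraMap B K (algebraMap (MvPolynomial (Fin 2) ℂ) B (X i))
  have hs : ∀ r : MvPolynomial (Fin 2) ℂ, aeval s r = algebraMap B K (algebraMap _ B r) := by
    intro r
    have : aeval s = (IsScalarTower.toAlgHom ℂ B K).comp
        (IsScalarTower.toAlgHom ℂ (MvPolynomial (Fin 2) ℂ) B) := by
      ext i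
      simp [s]
    exact DFunLike.congr_fun this r
  have hsind : AlgebraicIndependent ℂ s := fun a b hab =>
    hB (hBK (by rwa [← hs, ← hs]))
  let G : Fin 3 → K := fun i => algebraMap B K (F i)
  let L := IntermediateField.adjoin ℂ (Set.range G)
  have hloc : ∀ b : B, ∃ a d : MvPolynomial (Fin 2) ℂ, aeval s d ≠ 0 ∧
      algebraMap B K b * aeval s d = aeval s a := by
    intro b
    obtain ⟨⟨a, d⟩, had⟩ := IsLocalization.surj M b
    refine ⟨a, d, ?_, ?_⟩
    · rw [hs, ne_eq, map_eq_zero_iff _ hBK, map_eq_zero_iff _ hB]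
      exact nonZeroDivisors.ne_zero (hM d.2)
    · rw [hs, hs, ← had, map_mul]
  have hK : ∀ k : K, ∃ a b : MvPolynomial (Fin 2) ℂ, aeval s b ≠ 0 ∧ k * aeval s b = aeval s a := by
    intro k
    obtain ⟨b, c, hc, rfl⟩ := IsFractionRing.div_surjective (A := B) k
    have hc0 : algebraMap B K c ≠ 0 := (map_ne_zero_iff _ hBK).2 (nonZeroDivisors.ne_zero hc)
    obtain ⟨a₁, d₁, h₁, e₁⟩ := hloc b
    obtain ⟨a₂, d₂, h₂, e₂⟩ := hloc c
    refine ⟨a₁ * d₂, d₁ * a₂, ?_, ?_⟩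
    · rw [map_mul, ← e₂]
      exact mul_ne_zero h₁ (mul_ne_zero hc0 h₂)
    · rw [map_mul, map_mul, ← e₁, ← e₂]
      rw [div_mul_eq_mul_div, div_eq_iff hc0]
      ring
  have hxy : AlgebraicIndependent ℂ (algebraMap B K ∘ ![F 0, F 1]) :=
    hind.map' (f := IsScalarTower.toAlgHom ℂ B K) hBK
  have : Algebra.IsAlgebraic L K := by
    have := isAlgebraic_adjoin_range_of_algebraicIndependent hK hxy
    have hle : IntermediateField.adjoin ℂ (Set.range (algebraMap B K ∘ ![F 0, F 1])) ≤ L := by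
      refine IntermediateField.adjoin.mono _ _ _ ?_
      rintro _ ⟨i, rfl⟩
      exact ⟨i.castSucc, by fin_cases i <;> rfl⟩
    let _ := (IntermediateField.inclusion hle).toAlgebra
    have : IsScalarTower
        (IntermediateField.adjoin ℂ (Set.range (algebraMap B K ∘ ![F 0, F 1]))) L K :=
      .of_algebraMap_eq fun _ => rfl
    exact .tower_top (K := IntermediateField.adjoin ℂ (Set.range (algebraMap B K ∘ ![F 0, F 1]))) L
  have hsL : ∀ j, s j ∈ L := mem_of_generically_injective (p := p) (q := q) (F := G) hsind L
    (fun i => IntermediateField.subset_adjoin _ _ ⟨i, rfl⟩) (fun i => by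
      rw [hs, hs, ← map_mul, mul_comm, hF])
    hg hinj
  have htL : algebraMap B K t ∈ L := by
    obtain ⟨a, d, hd, had⟩ := hloc t
    have hmem : ∀ r : MvPolynomial (Fin 2) ℂ, aeval s r ∈ L := fun r => by
      induction r using MvPolynomial.induction_on with
      | C c => simp
      | add p q hp hq => simpa using add_mem hp hq
      | mul_X p i hp => simpa using mul_mem hp (hsL i)
    rw [eq_div_of_mul_eq hd had]
    exact div_mem (hmem a) (hmem d)
  obtain ⟨a, b, hab⟩ := (IntermediateField.mem_adjoin_range_iff ℂ G _).1 htL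
  have hG : ∀ r : MvPolynomial (Fin 3) ℂ, aeval G r = algebraMap B K (aeval F r) := fun r =>
    (comp_aeval_apply F (IsScalarTower.toAlgHom ℂ B K) r).symm
  rw [hG, hG] at hab
  by_cases hb : aeval F b = 0
  · rw [hb, map_zero, div_zero, map_eq_zero_iff _ hBK] at hab
    exact ⟨1, one_mem _, one_ne_zero, by rw [hab, mul_zero]; exact zero_mem _⟩
  · refine ⟨_, ⟨b, rfl⟩, hb, a, hBK ?_⟩
    change algebraMap B K (aeval F a) = algebraMap B K (aeval F b * t)
    rw [map_mul, hab, mul_div_cancel₀ _ ((map_ne_zero_iff _ hBK).2 hb)]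

open MvPolynomial in
theorem false_of_birational_surjective_parametrization_fermat
    {p₁ p₂ p₃ q₁ q₂ q₃ h : MvPolynomial (Fin 2) ℂ}
    (B : Type*) [CommRing B] [IsDomain B] [UniqueFactorizationMonoid B] [Algebra ℂ B]
    [Algebra (MvPolynomial (Fin 2) ℂ) B] [IsScalarTower ℂ (MvPolynomial (Fin 2) ℂ) B]
    [IsLocalization.Away (q₁ * q₂ * q₃) B] (hq : q₁ * q₂ * q₃ ≠ 0) (hh : h ≠ 0)
    (himg : (fun st : ℂ × ℂ =>
          (eval ![st.1, st.2] p₁ / eval ![st.1, st.2] q₁,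
           eval ![st.1, st.2] p₂ / eval ![st.1, st.2] q₂,
           eval ![st.1, st.2] p₃ / eval ![st.1, st.2] q₃)) ''
        {st : ℂ × ℂ | eval ![st.1, st.2] (q₁ * q₂ * q₃) ≠ 0} =
        {xyz : ℂ × ℂ × ℂ | xyz.1 ^ 3 + xyz.2.1 ^ 3 + xyz.2.2 ^ 3 = 1})
    (hinj : Set.InjOn
        (fun st : ℂ × ℂ =>
          (eval ![st.1, st.2] p₁ / eval ![st.1, st.2] q₁,
           eval ![st.1, st.2] p₂ / eval ![st.1, st.2] q₂,
           eval ![st.1, st.2] p₃ / eval ![st.1, st.2] q₃))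
        {st : ℂ × ℂ | eval ![st.1, st.2] (q₁ * q₂ * q₃) ≠ 0 ∧
          eval ![st.1, st.2] h ≠ 0}) : False := by
  have hM : Submonoid.powers (q₁ * q₂ * q₃) ≤ nonZeroDivisors (MvPolynomial (Fin 2) ℂ) :=
    powers_le_nonZeroDivisors_of_noZeroDivisors hq
  have hu : IsUnit (algebraMap (MvPolynomial (Fin 2) ℂ) B (q₁ * q₂ * q₃)) :=
    IsLocalization.Away.algebraMap_isUnit _
  simp only [map_mul, IsUnit.mul_iff] at hu
  obtain ⟨x, hx⟩ : ∃ x : B, algebraMap _ B q₁ * x = algebraMap _ B p₁ :=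
    hu.1.1.exists_right_inv.imp' (fun b => b * algebraMap _ B p₁) fun b hb => by
      rw [← mul_assoc, hb, one_mul]
  obtain ⟨y, hy⟩ : ∃ x : B, algebraMap _ B q₂ * x = algebraMap _ B p₂ :=
    hu.1.2.exists_right_inv.imp' (fun b => b * algebraMap _ B p₂) fun b hb => by
      rw [← mul_assoc, hb, one_mul]
  obtain ⟨z, hz⟩ : ∃ x : B, algebraMap _ B q₃ * x = algebraMap _ B p₃ :=
    hu.2.exists_right_inv.imp' (fun b => b * algebraMap _ B p₃) fun b hb => by
      rw [← mul_assoc, hb, one_mul]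
  have hval : ∀ w : ℂ × ℂ, eval ![w.1, w.2] (q₁ * q₂ * q₃) ≠ 0 →
      (eval ![w.1, w.2] p₁ / eval ![w.1, w.2] q₁) ^ 3 +
      (eval ![w.1, w.2] p₂ / eval ![w.1, w.2] q₂) ^ 3 +
      (eval ![w.1, w.2] p₃ / eval ![w.1, w.2] q₃) ^ 3 = 1 := by
    intro w hw
    have := himg.subset (Set.mem_image_of_mem _ (Set.mem_ofPred.2 hw))
    simpa only [Set.mem_ofPred_eq] using this
  have hP : (p₁ * q₂ * q₃) ^ 3 + (p₂ * q₁ * q₃) ^ 3 + (p₃ * q₁ * q₂) ^ 3 =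
      (q₁ * q₂ * q₃) ^ 3 := by
    refine mul_right_cancel₀ hq (MvPolynomial.funext fun w => ?_)
    rw [map_mul _ _ (q₁ * q₂ * q₃), map_mul _ _ (q₁ * q₂ * q₃)]
    by_cases hw : eval w (q₁ * q₂ * q₃) = 0
    · rw [hw, mul_zero, mul_zero]
    congr 1
    obtain ⟨u, v, rfl⟩ : ∃ u v, w = ![u, v] := ⟨w 0, w 1, by ext i; fin_cases i <;> rfl⟩
    have := hval (u, v) hw
    simp only [map_mul, mul_ne_zero_iff, map_add, map_pow] at hw this ⊢
    obtain ⟨⟨h1, h2⟩, h3⟩ : (eval ![u, v] q₁ ≠ 0 ∧ eval ![u, v] q₂ ≠ 0) ∧ eval ![u, v] q₃ ≠ 0 := by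
      simpa [not_or] using hw
    field_simp at this
    linear_combination this
  have hS : x ^ 3 + y ^ 3 + z ^ 3 = 1 := by
    refine ((hu.1.1.mul hu.1.2).mul hu.2 |>.pow 3).mul_left_cancel ?_
    have := congrArg (algebraMap _ B) hP
    simp only [map_add, map_mul, map_pow, ← hx, ← hy, ← hz] at this
    linear_combination this
  have hsurj : ∀ u v w : ℂ, u ^ 3 + v ^ 3 + w ^ 3 = 1 →
      ∃ ε : B →ₐ[ℂ] ℂ, ε x = u ∧ ε y = v ∧ ε z = w := by
    intro u v w huvw
    obtain ⟨a, ha, hfa⟩ := himg.superset (show (u, v, w) ∈ _ from huvw)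
    simp only [Prod.mk.injEq] at hfa
    have ha' : (eval ![a.1, a.2] q₁ ≠ 0 ∧ eval ![a.1, a.2] q₂ ≠ 0) ∧ eval ![a.1, a.2] q₃ ≠ 0 := by
      simpa [not_or] using ha
    let ε : B →ₐ[ℂ] ℂ := IsLocalization.liftAlgHom (M := Submonoid.powers (q₁ * q₂ * q₃))
      (f := (aeval ![a.1, a.2] : MvPolynomial (Fin 2) ℂ →ₐ[ℂ] ℂ)) (by
        rintro ⟨_, n, rfl⟩
        rw [map_pow]
        exact (IsUnit.mk0 _ ha).pow n)
    have hε : ∀ r, ε (algebraMap _ B r) = eval ![a.1, a.2] r := fun r =>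
      IsLocalization.lift_eq _ r
    refine ⟨ε, ?_, ?_, ?_⟩
    · rw [← hfa.1, eq_div_iff ha'.1.1, ← hε, ← hε, ← map_mul, mul_comm, hx]
    · rw [← hfa.2.1, eq_div_iff ha'.1.2, ← hε, ← hε, ← map_mul, mul_comm, hy]
    · rw [← hfa.2.2, eq_div_iff ha'.2, ← hε, ← hε, ← map_mul, mul_comm, hz]
  refine false_of_fermat_parametrization hS hsurj ?_
  have hind : AlgebraicIndependent ℂ ![x, y] := algebraicIndependent_of_fermat hsurj
  refine exists_mul_mem_range_aeval_of_generically_injective (F := ![x, y, z])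
    (p := ![p₁, p₂, p₃]) (q := ![q₁, q₂, q₃]) hM hind (fun i => ?_) (mul_ne_zero hq hh) ?_
  · fin_cases i
    exacts [hx, hy, hz]
  · have hvec : ∀ v : Fin 2 → ℂ, ![v 0, v 1] = v := fun v => by ext i; fin_cases i <;> rfl
    intro v w hv hw hvw
    rw [map_mul, mul_ne_zero_iff] at hv hw
    have hv' := hv.1
    have hw' := hw.1
    simp only [map_mul, mul_ne_zero_iff] at hv' hw'
    have := @hinj (v 0, v 1) (by simpa only [Set.mem_ofPred_eq, hvec] using hv) (w 0, w 1)
      (by simpa only [Set.mem_ofPred_eq, hvec] using hw) (by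
        simp only [hvec, Prod.mk.injEq]
        exact ⟨(div_eq_div_iff hv'.1.1 hw'.1.1).2 (hvw 0),
          (div_eq_div_iff hv'.1.2 hw'.1.2).2 (hvw 1), (div_eq_div_iff hv'.2 hw'.2).2 (hvw 2)⟩)
    rw [← hvec v, ← hvec w, (Prod.mk.inj this).1, (Prod.mk.inj this).2]

open MvPolynomial

/-- There is no birational surjective rational parametrization of the Fermat cubic
surface `S = {(x,y,z) ∈ ℂ³ : x³ + y³ + z³ = 1}`.  A rational map `ℂ² ⇢ ℂ³` is
represented by polynomials `pᵢ, qᵢ ∈ ℂ[s,t]` with `qᵢ ≠ 0` and `gcd(pᵢ,qᵢ) = 1`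
(formalized as `IsRelPrime (pᵢ) (qᵢ)`), defined on
`U = {(s,t) : q₁(s,t)·q₂(s,t)·q₃(s,t) ≠ 0}` by `f = (p₁/q₁, p₂/q₂, p₃/q₃)`;
birationality is expressed by injectivity on the nonempty Zariski-open subset
`{(s,t) ∈ U : h(s,t) ≠ 0}` for some nonzero `h ∈ ℂ[s,t]`. -/
theorem no_birational_surjective_parametrization_fermat_cubic :
    ¬ ∃ (p₁ p₂ p₃ q₁ q₂ q₃ h : MvPolynomial (Fin 2) ℂ),
      q₁ ≠ 0 ∧ q₂ ≠ 0 ∧ q₃ ≠ 0 ∧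
      IsRelPrime p₁ q₁ ∧ IsRelPrime p₂ q₂ ∧ IsRelPrime p₃ q₃ ∧
      h ≠ 0 ∧
      (fun st : ℂ × ℂ =>
          (eval ![st.1, st.2] p₁ / eval ![st.1, st.2] q₁,
           eval ![st.1, st.2] p₂ / eval ![st.1, st.2] q₂,
           eval ![st.1, st.2] p₃ / eval ![st.1, st.2] q₃)) ''
        {st : ℂ × ℂ | eval ![st.1, st.2] (q₁ * q₂ * q₃) ≠ 0} =
        {xyz : ℂ × ℂ × ℂ | xyz.1 ^ 3 + xyz.2.1 ^ 3 + xyz.2.2 ^ 3 = 1} ∧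
      Set.InjOn
        (fun st : ℂ × ℂ =>
          (eval ![st.1, st.2] p₁ / eval ![st.1, st.2] q₁,
           eval ![st.1, st.2] p₂ / eval ![st.1, st.2] q₂,
           eval ![st.1, st.2] p₃ / eval ![st.1, st.2] q₃))
        {st : ℂ × ℂ | eval ![st.1, st.2] (q₁ * q₂ * q₃) ≠ 0 ∧
          eval ![st.1, st.2] h ≠ 0} := by
  rintro ⟨p₁, p₂, p₃, q₁, q₂, q₃, h, hq₁, hq₂, hq₃, -, -, -, hh, himg, hinj⟩
  have hq : q₁ * q₂ * q₃ ≠ 0 := mul_ne_zero (mul_ne_zero hq₁ hq₂) hq₃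
  have : IsDomain (Localization.Away (q₁ * q₂ * q₃)) :=
    IsLocalization.isDomain_localization (powers_le_nonZeroDivisors_of_noZeroDivisors hq)
  exact false_of_birational_surjective_parametrization_fermat
    (Localization.Away (q₁ * q₂ * q₃)) hq hh himg hinj
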